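/- arXiv:0908.0688 — 2 statements merged into one kernel-verified Lean document; each statement's English description precedes it below -/
import Mathlib

section
/- Let n ≥ 2, let 𝒪 ⊂ ℝⁿ be open, and let f : 𝒪 × S^{n-1} → [0,∞) be a nonnegative upper semicontinuous function. Fix x₀ ∈ 𝒪 and ε > 0, and suppose that the set {ξ ∈ S^{n-1} : f(x₀,ξ) ≠ 0} has surface measure at most ε/2. Then for every ρ > 0 there exist an open neighborhood 𝒩 ⊂ 𝒪 of x₀ and a smooth function b ∈ C^∞(S^{n-1}) with 0 ≤ b ≤ 1 and ∫_{S^{n-1}} b dσ ≤ ε, such that, setting B = 1 − b, one has f(x,ξ) ≤ ρ for every x ∈ 𝒩 and every ξ in the support of B. -/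
open MeasureTheory

/-- the smooth version of the localization lemma. Under the same
hypotheses as in Statement 0, for every `ρ > 0` there are an open neighborhood
`𝒩 ⊆ 𝒪` of `x₀` and a smooth function `b` (a smooth function on the sphere,
realized as the restriction of a smooth function on `ℝⁿ`) with values in `[0,1]`
on the sphere and `∫_{S^{n-1}} b dσ ≤ ε`, such that with `B = 1 - b` one has
`f(x,ξ) ≤ ρ` for all `x ∈ 𝒩` and all `ξ` in the support of `B` (the closure,
in the sphere, of the set where `B ≠ 0`). The surface measure on the unit
sphere is `volume.toSphere`. -/
theorem stmt_1 (n : ℕ) (hn : 2 ≤ n)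
    (O : Set (EuclideanSpace ℝ (Fin n))) (hO : IsOpen O)
    (f : EuclideanSpace ℝ (Fin n) → Metric.sphere (0 : EuclideanSpace ℝ (Fin n)) 1 → ℝ)
    (hf_nonneg : ∀ x ∈ O, ∀ ξ, 0 ≤ f x ξ)
    (hf_usc : UpperSemicontinuousOn
      (fun p : EuclideanSpace ℝ (Fin n) × Metric.sphere (0 : EuclideanSpace ℝ (Fin n)) 1 =>
        f p.1 p.2) (O ×ˢ Set.univ))
    (x₀ : EuclideanSpace ℝ (Fin n)) (hx₀ : x₀ ∈ O) (ε : ℝ) (hε : 0 < ε)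
    (hsmall : (volume : Measure (EuclideanSpace ℝ (Fin n))).toSphere {ξ | f x₀ ξ ≠ 0}
      ≤ ENNReal.ofReal (ε / 2))
    (ρ : ℝ) (hρ : 0 < ρ) :
    ∃ N : Set (EuclideanSpace ℝ (Fin n)), IsOpen N ∧ x₀ ∈ N ∧ N ⊆ O ∧
      ∃ b : EuclideanSpace ℝ (Fin n) → ℝ, ContDiff ℝ (⊤ : ℕ∞) b ∧
        (∀ ξ : Metric.sphere (0 : EuclideanSpace ℝ (Fin n)) 1, 0 ≤ b ↑ξ ∧ b ↑ξ ≤ 1) ∧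
        (∫ ξ : Metric.sphere (0 : EuclideanSpace ℝ (Fin n)) 1, b ↑ξ
          ∂(volume : Measure (EuclideanSpace ℝ (Fin n))).toSphere) ≤ ε ∧
        ∀ x ∈ N, ∀ ξ : Metric.sphere (0 : EuclideanSpace ℝ (Fin n)) 1,
          ξ ∈ closure {η : Metric.sphere (0 : EuclideanSpace ℝ (Fin n)) 1 | 1 - b ↑η ≠ 0} →
            f x ξ ≤ ρ := by
  classical
  let S := Metric.sphere (0 : EuclideanSpace ℝ (Fin n)) 1
  let σ : Measure S := (volume : Measure (EuclideanSpace ℝ (Fin n))).toSphere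
  let W : Set (EuclideanSpace ℝ (Fin n) × S) := {p | ∀ᶠ q in nhds p, f q.1 q.2 < ρ}
  have hWo : IsOpen W := isOpen_setOfPred_eventually_nhds
  have hOo : IsOpen (O ×ˢ (Set.univ : Set S)) := hO.prod isOpen_univ
  have hW : ∀ ξ : S, f x₀ ξ < ρ → (x₀, ξ) ∈ W := by
    intro ξ h
    have h1 := hf_usc (x₀, ξ) ⟨hx₀, Set.mem_univ _⟩ ρ h
    rwa [hOo.nhdsWithin_eq ⟨hx₀, Set.mem_univ _⟩] at h1
  have hW' : ∀ p ∈ W, f p.1 p.2 < ρ := by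
    intro p hp
    have h : ∀ᶠ q in nhds p, f q.1 q.2 < ρ := hp
    exact h.self_of_nhds
  let K : Set S := {ξ | (x₀, ξ) ∈ W}ᶜ
  have hKc : IsClosed K :=
    (hWo.preimage (by fun_prop : Continuous fun ξ : S => (x₀, ξ))).isClosed_compl
  have hKm : σ K < ENNReal.ofReal ε := by
    refine lt_of_le_of_lt ((measure_mono ?_).trans hsmall) ?_
    · intro ξ hξ h0
      exact hξ (hW ξ (by rw [h0]; exact hρ))
    · exact (ENNReal.ofReal_lt_ofReal_iff hε).2 (by linarith)
  obtain ⟨U, hKU, hUo, hUm⟩ := K.exists_isOpen_lt_of_lt _ hKm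
  have hemb : Topology.IsClosedEmbedding (Subtype.val : S → EuclideanSpace ℝ (Fin n)) :=
    Metric.isClosed_sphere.isClosedEmbedding_subtypeVal
  obtain ⟨b, hb0, hb1, hb⟩ := exists_contMDiffMap_zero_one_nhds_of_isClosed (n := (⊤ : ℕ∞))
    (modelWithCornersSelf ℝ (EuclideanSpace ℝ (Fin n)))
    (hemb.isClosedMap _ hUo.isClosed_compl) (hemb.isClosedMap _ hKc)
    ((Set.disjoint_image_iff Subtype.val_injective).2
      (Set.disjoint_left.2 fun x hx hx' => hx (hKU hx')))
  let L : Set S := closure {η : S | 1 - b ↑η ≠ 0}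
  have hL : ∀ ξ ∈ L, (x₀, ξ) ∈ W := by
    intro ξ hξ
    by_contra hK
    have h1 : ∀ᶠ x in nhds (ξ : EuclideanSpace ℝ (Fin n)), b x = 1 :=
      hb1.filter_mono (nhds_le_nhdsSet (Set.mem_image_of_mem _ hK))
    have h2 : ∀ᶠ η : S in nhds ξ, b ↑η = 1 := continuous_subtype_val.continuousAt.eventually h1
    obtain ⟨η, h3, h4⟩ := ((mem_closure_iff_frequently.1 hξ).and_eventually h2).exists
    exact h3 (by rw [h4, sub_self])
  obtain ⟨u, v, hu, hv, hxu, hLv, huv⟩ := generalized_tube_lemma (isCompact_singleton (x := x₀))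
    (isClosed_closure.isCompact : IsCompact L) hWo (by
      rintro ⟨x, ξ⟩ ⟨hx, hξ⟩
      obtain rfl : x = x₀ := hx
      exact hL ξ hξ)
  refine ⟨u ∩ O, hu.inter hO, ⟨hxu rfl, hx₀⟩, Set.inter_subset_right, b, b.contMDiff.contDiff,
    fun ξ => hb ξ, ?_, ?_⟩
  · have h1 : ∫ ξ : S, b ↑ξ ∂σ ≤ ∫ ξ : S, U.indicator (1 : S → ℝ) ξ ∂σ := by
      refine integral_mono_of_nonneg (Filter.Eventually.of_forall fun ξ => (hb ξ).1)
        ((integrable_const 1).indicator hUo.measurableSet) (Filter.Eventually.of_forall fun ξ => ?_)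
      by_cases h : ξ ∈ U
      · simpa [h] using (hb ξ).2
      · have : b ξ = 0 := hb0.self_of_nhdsSet _ ⟨ξ, h, rfl⟩
        simp [h, this]
    refine h1.trans ?_
    rw [integral_indicator_one hUo.measurableSet]
    exact ENNReal.toReal_le_of_le_ofReal hε.le hUm.le
  · intro x hx ξ hξ
    exact (hW' (x, ξ) (huv ⟨hx.1, hLv hξ⟩)).le
end

section
/- Let n ≥ 2 and for ħ > 0 define u_ħ : ℝⁿ → ℂ by u_ħ(x) = ħ^{(1-n)/2} ∫_{S^{n-1}} e^{i⟨x,ω⟩/ħ} dσ(ω). Fix δ ∈ (1 − 1/n, 1) and set δ' = min(1 − (1−δ)n, δ). Then there exist a constant c_n > 0 depending only on n, and for each ε₀ ∈ (0,1] a constant C (depending only on n and δ), such that for all sufficiently small ħ > 0, |∫_{|x| ≤ ε₀} |u_ħ(x)|² dx − c_n ε₀| ≤ C ħ^{δ'}. In particular ∫_{|x| ≤ ε₀} |u_ħ|² dx converges to c_n ε₀ as ħ → 0⁺. -/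
open MeasureTheory
open scoped RealInnerProductSpace
/-- The model quasimode `u_ħ(x) = ħ^{(1-n)/2} ∫_{S^{n-1}} e^{i⟨x,ω⟩/ħ} dσ(ω)`,
where `σ = volume.toSphere` is the surface measure on the unit sphere. -/
noncomputable def uh (n : ℕ) (h : ℝ) (x : EuclideanSpace ℝ (Fin n)) : ℂ :=
  (h ^ ((1 - (n : ℝ)) / 2) : ℝ) *
    ∫ ω : Metric.sphere (0 : EuclideanSpace ℝ (Fin n)) 1,
      Complex.exp (Complex.I * (⟪x, (ω : EuclideanSpace ℝ (Fin n))⟫ / h))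
      ∂(volume : Measure (EuclideanSpace ℝ (Fin n))).toSphere


lemma ode_energy (g g1 : ℝ → ℝ) (κ : ℝ)
    (hg : ∀ r > 0, HasDerivAt g (g1 r) r)
    (hg1 : ∀ r > 0, HasDerivAt g1 (-(1 - κ / r ^ 2) * g r) r)
    (hne : ∃ r > 0, g r ≠ 0) :
    ∃ L > 0, ∃ M : ℝ, 0 ≤ M ∧ ∀ r ≥ 1, g r ^ 2 + g1 r ^ 2 ≤ M ∧
      |g r ^ 2 + g1 r ^ 2 - L| ≤ M / r := by
  set k := |κ| with hk
  have hk0 : 0 ≤ k := abs_nonneg _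
  set E : ℝ → ℝ := fun r => g r ^ 2 + g1 r ^ 2 with hE
  have hE0 : ∀ r, 0 ≤ E r := fun r => by simp only [hE]; positivity
  have hEd : ∀ r > 0, HasDerivAt E (2 * κ * (g r * g1 r) / r ^ 2) r := by
    intro r hr
    have := ((hg r hr).pow 2).add ((hg1 r hr).pow 2)
    refine this.congr_deriv ?_
    field_simp
    push_cast
    ring
  have hEb : ∀ r > 0, |2 * κ * (g r * g1 r) / r ^ 2| ≤ k * E r / r ^ 2 := by
    intro r hr
    rw [abs_div, abs_of_pos (show 0 < r ^ 2 by positivity)]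
    gcongr
    rw [show 2 * κ * (g r * g1 r) = κ * (2 * g r * g1 r) by ring, abs_mul]
    gcongr
    rw [abs_le]
    constructor <;> simp only [hE] <;> nlinarith [sq_nonneg (g r + g1 r), sq_nonneg (g r - g1 r)]
  have hexp : ∀ (a : ℝ) (r : ℝ), r > 0 →
      HasDerivAt (fun r => Real.exp (a / r)) (Real.exp (a / r) * (-a / r ^ 2)) r := by
    intro a r hr
    have h1 : HasDerivAt (fun r : ℝ => a / r) (-a / r ^ 2) r := by
      have := (hasDerivAt_inv hr.ne').const_mul a
      refine (this.congr_deriv (by field_simp)).congr_of_eventuallyEq ?_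
      filter_upwards with x using by simp [div_eq_mul_inv]
    exact h1.exp
  set A : ℝ → ℝ := fun r => E r * Real.exp (-k / r) with hA
  set B : ℝ → ℝ := fun r => E r * Real.exp (k / r) with hB
  have hAd : ∀ r > 0, HasDerivAt A (2 * κ * (g r * g1 r) / r ^ 2 * Real.exp (-k / r) +
      E r * (Real.exp (-k / r) * (-(-k) / r ^ 2))) r := fun r hr => (hEd r hr).mul (hexp (-k) r hr)
  have hBd : ∀ r > 0, HasDerivAt B (2 * κ * (g r * g1 r) / r ^ 2 * Real.exp (k / r) +
      E r * (Real.exp (k / r) * (-k / r ^ 2))) r := fun r hr => (hEd r hr).mul (hexp k r hr)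
  have hAm : MonotoneOn A (Set.Ioi 0) := by
    refine monotoneOn_of_deriv_nonneg (convex_Ioi 0)
      (fun r hr => (hAd r hr).continuousAt.continuousWithinAt)
      (fun r hr => ?_) (fun r hr => ?_)
    · rw [interior_Ioi] at hr
      exact (hAd r hr).differentiableAt.differentiableWithinAt
    · rw [interior_Ioi] at hr
      rw [(hAd r hr).deriv]
      have := (abs_le.1 (hEb r hr)).1
      have h2 := Real.exp_pos (-k / r)
      have : 0 ≤ (2 * κ * (g r * g1 r) / r ^ 2 + k * E r / r ^ 2) * Real.exp (-k / r) :=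
        mul_nonneg (by linarith) h2.le
      convert this using 1
      ring
  have hBm : AntitoneOn B (Set.Ioi 0) := by
    refine antitoneOn_of_deriv_nonpos (convex_Ioi 0)
      (fun r hr => (hBd r hr).continuousAt.continuousWithinAt)
      (fun r hr => ?_) (fun r hr => ?_)
    · rw [interior_Ioi] at hr
      exact (hBd r hr).differentiableAt.differentiableWithinAt
    · rw [interior_Ioi] at hr
      rw [(hBd r hr).deriv]
      have := (abs_le.1 (hEb r hr)).2
      have h2 := Real.exp_pos (k / r)
      have : (2 * κ * (g r * g1 r) / r ^ 2 - k * E r / r ^ 2) * Real.exp (k / r) ≤ 0 :=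
        mul_nonpos_of_nonpos_of_nonneg (by linarith) h2.le
      convert this using 1
      ring
  have hAB : ∀ r > 0, A r ≤ B r := by
    intro r hr
    simp only [hA, hB]
    have := hE0 r
    gcongr
    linarith
  have hAB' : ∀ r > 0, ∀ s > 0, A r ≤ B s := by
    intro r hr s hs
    have hm : 0 < max r s := lt_max_of_lt_left hr
    exact (hAm hr hm (le_max_left _ _)).trans ((hAB _ hm).trans (hBm hs hm (le_max_right _ _)))
  set L := sSup (A '' Set.Ioi 0) with hL
  have hbdd : BddAbove (A '' Set.Ioi 0) := ⟨B 1, by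
    rintro _ ⟨r, hr, rfl⟩; exact hAB' r hr 1 one_pos⟩
  have hLA : ∀ r > 0, A r ≤ L := fun r hr => le_csSup hbdd ⟨r, hr, rfl⟩
  have hLB : ∀ r > 0, L ≤ B r := fun r hr => csSup_le ⟨A 1, 1, Set.mem_Ioi.2 one_pos, rfl⟩ (by
    rintro _ ⟨s, hs, rfl⟩; exact hAB' s hs r hr)
  obtain ⟨r₀, hr₀, hgr₀⟩ := hne
  have hLpos : 0 < L := by
    refine lt_of_lt_of_le ?_ (hLA r₀ hr₀)
    have : 0 < E r₀ := by simp only [hE]; positivity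
    positivity
  have hEB : ∀ r ≥ 1, E r ≤ B 1 := by
    intro r hr
    have hr0 : (0:ℝ) < r := by linarith
    refine le_trans ?_ (hBm (Set.mem_Ioi.2 one_pos) hr0 hr)
    exact le_mul_of_one_le_right (hE0 r) (Real.one_le_exp (by positivity))
  have hB1 : 0 ≤ B 1 := hLpos.le.trans (hLB 1 one_pos)
  refine ⟨L, hLpos, B 1 + B 1 * k, by positivity, fun r hr => ⟨?_, ?_⟩⟩
  · exact (hEB r hr).trans (by nlinarith)
  · have hr0 : (0:ℝ) < r := by linarith
    change |E r - L| ≤ _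
    have h1 : 1 - k / r ≤ Real.exp (-k / r) := by
      have := Real.add_one_le_exp (-k / r)
      rw [neg_div] at *
      linarith
    have h2 : E r * Real.exp (-k / r) ≤ L := hLA r hr0
    have h3 : L * Real.exp (-k / r) ≤ E r := by
      have : L * Real.exp (-k / r) ≤ B r * Real.exp (-k / r) := by gcongr; exact hLB r hr0
      refine this.trans (le_of_eq ?_)
      simp only [hB]
      rw [mul_assoc, ← Real.exp_add, neg_div, add_neg_cancel, Real.exp_zero, mul_one]
    have h4 : (B 1 + B 1 * k) / r = B 1 / r + B 1 * (k / r) := by ring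
    have h5 : 0 ≤ B 1 / r := by positivity
    have h6 : 0 ≤ k / r := by positivity
    rw [h4, abs_le]
    constructor
    · nlinarith [hLB 1 one_pos, mul_le_mul_of_nonneg_right (hLB 1 one_pos) h6,
        mul_le_mul_of_nonneg_left h1 hLpos.le]
    · nlinarith [hEB r hr, mul_le_mul_of_nonneg_right (hEB r hr) h6,
        mul_le_mul_of_nonneg_left h1 (hE0 r)]

lemma ode_integral (g g1 : ℝ → ℝ) (κ : ℝ)
    (hg : ∀ r > 0, HasDerivAt g (g1 r) r)
    (hg1 : ∀ r > 0, HasDerivAt g1 (-(1 - κ / r ^ 2) * g r) r)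
    (hne : ∃ r > 0, g r ≠ 0) :
    ∃ L > 0, ∃ K : ℝ, 0 ≤ K ∧ ∀ R ≥ 1,
      |(∫ r in (1:ℝ)..R, g r ^ 2) - L * R| ≤ K * (1 + Real.log R) := by
  obtain ⟨L, hL, M, hM, h⟩ := ode_energy g g1 κ hg hg1 hne
  set E : ℝ → ℝ := fun r => g r ^ 2 + g1 r ^ 2 with hE
  have hcont : ContinuousOn (fun r => g r ^ 2) (Set.Ioi 0) := fun r hr =>
    ((hg r hr).continuousAt.pow 2).continuousWithinAt
  set W : ℝ → ℝ := fun R => 2 * (∫ r in (1:ℝ)..R, g r ^ 2) - L * R + g R * g1 R with hW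
  have hId : ∀ r > 0, HasDerivAt (fun R => ∫ r in (1:ℝ)..R, g r ^ 2) (g r ^ 2) r := by
    intro r hr
    refine intervalIntegral.integral_hasDerivAt_right ?_ ?_ ?_
    · apply ContinuousOn.intervalIntegrable
      refine hcont.mono ?_
      intro x hx
      rw [Set.mem_uIcc] at hx
      rcases hx with hx | hx
      · exact lt_of_lt_of_le one_pos hx.1
      · exact lt_of_lt_of_le hr hx.1
    · exact hcont.stronglyMeasurableAtFilter isOpen_Ioi r hr
    · exact (hg r hr).continuousAt.pow 2
  have hWd : ∀ r > 0, HasDerivAt W (E r - L + κ * g r ^ 2 / r ^ 2) r := by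
    intro r hr
    have := (((hId r hr).const_mul 2).sub ((hasDerivAt_id r).const_mul L)).add
      ((hg r hr).mul (hg1 r hr))
    refine this.congr_deriv ?_
    simp only [hE]
    field_simp
    ring
  set N := M + |κ| * M with hN
  have hN0 : 0 ≤ N := by positivity
  have hWb : ∀ r ≥ 1, |E r - L + κ * g r ^ 2 / r ^ 2| ≤ N / r := by
    intro r hr
    have hr0 : (0:ℝ) < r := by linarith
    refine (abs_add_le _ _).trans ?_
    rw [hN, add_div]
    refine add_le_add (h r hr).2 ?_
    rw [abs_div, abs_mul, abs_of_nonneg (sq_nonneg (g r)), abs_of_nonneg (sq_nonneg r)]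
    have h1 : g r ^ 2 ≤ M := by
      have := (h r hr).1
      nlinarith [sq_nonneg (g1 r)]
    have h2 : r ≤ r ^ 2 := by nlinarith
    gcongr
  have hp : ∀ x : ℝ, x ∈ Set.Ici (1:ℝ) → 0 < x := fun x hx => lt_of_lt_of_le one_pos hx
  have h1m : MonotoneOn (fun r => W r + N * Real.log r) (Set.Ici 1) := by
    have hd : ∀ r ∈ Set.Ici (1:ℝ), HasDerivAt (fun r => W r + N * Real.log r)
        ((E r - L + κ * g r ^ 2 / r ^ 2) + N * r⁻¹) r := fun r hr =>
      (hWd r (hp r hr)).add ((Real.hasDerivAt_log (hp r hr).ne').const_mul N)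
    refine monotoneOn_of_deriv_nonneg (convex_Ici 1)
      (fun r hr => (hd r hr).continuousAt.continuousWithinAt)
      (fun r hr => (hd r (interior_subset hr)).differentiableAt.differentiableWithinAt)
      (fun r hr => ?_)
    rw [(hd r (interior_subset hr)).deriv]
    have := (abs_le.1 (hWb r (interior_subset hr))).1
    rw [div_eq_mul_inv] at this
    linarith
  have h2m : AntitoneOn (fun r => W r - N * Real.log r) (Set.Ici 1) := by
    have hd : ∀ r ∈ Set.Ici (1:ℝ), HasDerivAt (fun r => W r - N * Real.log r)
        ((E r - L + κ * g r ^ 2 / r ^ 2) - N * r⁻¹) r := fun r hr =>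
      (hWd r (hp r hr)).sub ((Real.hasDerivAt_log (hp r hr).ne').const_mul N)
    refine antitoneOn_of_deriv_nonpos (convex_Ici 1)
      (fun r hr => (hd r hr).continuousAt.continuousWithinAt)
      (fun r hr => (hd r (interior_subset hr)).differentiableAt.differentiableWithinAt)
      (fun r hr => ?_)
    rw [(hd r (interior_subset hr)).deriv]
    have := (abs_le.1 (hWb r (interior_subset hr))).2
    rw [div_eq_mul_inv (N)] at this
    linarith
  refine ⟨L / 2, by positivity, |W 1| + N + M, by positivity, fun R hR => ?_⟩
  have hlog : 0 ≤ Real.log R := Real.log_nonneg hR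
  have a1 := h1m (Set.mem_Ici.2 le_rfl) (Set.mem_Ici.2 hR) hR
  have a2 := h2m (Set.mem_Ici.2 le_rfl) (Set.mem_Ici.2 hR) hR
  simp only [Real.log_one, mul_zero, add_zero, sub_zero] at a1 a2
  have a3 : |g R * g1 R| ≤ M := by
    have := (h R hR).1
    rw [abs_le]
    constructor <;> nlinarith [sq_nonneg (g R + g1 R), sq_nonneg (g R - g1 R)]
  have a4 := abs_le.1 a3
  have a5 := neg_abs_le (W 1)
  have a6 := le_abs_self (W 1)
  have a7 : (∫ r in (1:ℝ)..R, g r ^ 2) - L / 2 * R = (W R - g R * g1 R) / 2 := by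
    simp only [hW]; ring
  have a8 := mul_nonneg (abs_nonneg (W 1)) hlog
  have a9 := mul_nonneg hM hlog
  have a10 := mul_nonneg hN0 hlog
  have a11 := abs_nonneg (W 1)
  rw [a7, abs_le]
  constructor <;> nlinarith

lemma sphere_invariant (n : ℕ) (T : EuclideanSpace ℝ (Fin n) ≃ₗᵢ[ℝ] EuclideanSpace ℝ (Fin n))
    (φ : EuclideanSpace ℝ (Fin n) → ℝ) (hφ : Continuous φ) :
    ∫ ω : Metric.sphere (0 : EuclideanSpace ℝ (Fin n)) 1, φ (T ω)
      ∂(volume : Measure (EuclideanSpace ℝ (Fin n))).toSphere =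
    ∫ ω : Metric.sphere (0 : EuclideanSpace ℝ (Fin n)) 1, φ ω
      ∂(volume : Measure (EuclideanSpace ℝ (Fin n))).toSphere := by
  let S : Metric.sphere (0 : EuclideanSpace ℝ (Fin n)) 1 →
      Metric.sphere (0 : EuclideanSpace ℝ (Fin n)) 1 := fun ω => ⟨T ω, by simp⟩
  have hS : Continuous S := by
    apply Continuous.subtype_mk
    exact T.continuous.comp continuous_subtype_val
  have hmap : Measure.map S (volume : Measure (EuclideanSpace ℝ (Fin n))).toSphere =
      (volume : Measure (EuclideanSpace ℝ (Fin n))).toSphere := by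
    ext s hs
    rw [Measure.map_apply hS.measurable hs, Measure.toSphere_apply' _ hs,
      Measure.toSphere_apply' _ (hS.measurable hs)]
    congr 1
    refine Eq.trans ?_ (MeasurePreserving.measure_preimage_equiv (f := T.toMeasurableEquiv)
      T.measurePreserving _)
    congr 1
    ext x
    rw [Set.mem_preimage]
    change _ ↔ T x ∈ _
    simp only [Set.mem_smul, Set.mem_image, Set.mem_preimage]
    constructor
    · rintro ⟨a, ha, _, ⟨ω, hω, rfl⟩, rfl⟩
      exact ⟨a, ha, _, ⟨S ω, hω, rfl⟩, by simp [S]⟩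
    · rintro ⟨a, ha, _, ⟨ω, hω, rfl⟩, h⟩
      refine ⟨a, ha, _, ⟨⟨T.symm ω, by simp⟩, ?_, rfl⟩, ?_⟩
      · simpa [S] using hω
      · have h' : a • (ω : EuclideanSpace ℝ (Fin n)) = T x := h
        simp only [← map_smul, h', LinearIsometryEquiv.symm_apply_apply]
  conv_rhs => rw [← hmap]
  rw [integral_map (f := fun ω : Metric.sphere (0 : EuclideanSpace ℝ (Fin n)) 1 => φ ω)
    hS.aemeasurable (hφ.comp continuous_subtype_val).aestronglyMeasurable]

lemma hasDerivAt_int {X : Type*} [TopologicalSpace X] [CompactSpace X] [MeasurableSpace X]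
    [BorelSpace X] (μ : Measure X) [IsFiniteMeasure μ] (G G' : ℝ → X → ℝ) (C : ℝ)
    (hG : ∀ t, Continuous (G t)) (hG' : ∀ t, Continuous (G' t))
    (hb : ∀ t x, |G' t x| ≤ C) (hd : ∀ t x, HasDerivAt (fun t => G t x) (G' t x) t) (t : ℝ) :
    HasDerivAt (fun t => ∫ x, G t x ∂μ) (∫ x, G' t x ∂μ) t := by
  refine (hasDerivAt_integral_of_dominated_loc_of_deriv_le (bound := fun _ => C)
    Filter.univ_mem ?_ ?_ ?_ ?_ ?_ ?_).2
  · exact Filter.Eventually.of_forall fun t =>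
      ((hG t).integrable_of_hasCompactSupport (HasCompactSupport.of_compactSpace _)).aestronglyMeasurable
  · exact (hG t).integrable_of_hasCompactSupport (HasCompactSupport.of_compactSpace _)
  · exact ((hG' t).integrable_of_hasCompactSupport (HasCompactSupport.of_compactSpace _)).aestronglyMeasurable
  · exact Filter.Eventually.of_forall fun x t _ => hb t x
  · exact integrable_const _
  · exact Filter.Eventually.of_forall fun x t _ => hd t x

noncomputable def Jf (n : ℕ) (x : EuclideanSpace ℝ (Fin n)) : ℝ :=
  ∫ ω : Metric.sphere (0 : EuclideanSpace ℝ (Fin n)) 1,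
      Real.cos ⟪x, (ω : EuclideanSpace ℝ (Fin n))⟫
      ∂(volume : Measure (EuclideanSpace ℝ (Fin n))).toSphere

lemma Jf_isom (n : ℕ) (T : EuclideanSpace ℝ (Fin n) ≃ₗᵢ[ℝ] EuclideanSpace ℝ (Fin n))
    (x : EuclideanSpace ℝ (Fin n)) : Jf n (T x) = Jf n x := by
  unfold Jf
  rw [← sphere_invariant n T (fun y => Real.cos ⟪T x, y⟫) (by fun_prop)]
  simp

lemma Jf_radial (n : ℕ) (x y : EuclideanSpace ℝ (Fin n)) (h : ‖x‖ = ‖y‖) : Jf n x = Jf n y := by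
  rw [← Jf_isom n ((Submodule.span ℝ {x - y})ᗮ.reflection) x, Submodule.reflection_sub h]

lemma sphere_integrable (n : ℕ) (φ : EuclideanSpace ℝ (Fin n) → ℝ) (hφ : Continuous φ) :
    Integrable (fun ω : Metric.sphere (0 : EuclideanSpace ℝ (Fin n)) 1 => φ ω)
      (volume : Measure (EuclideanSpace ℝ (Fin n))).toSphere :=
  (hφ.comp continuous_subtype_val).integrable_of_hasCompactSupport
    (HasCompactSupport.of_compactSpace _)

lemma sphere_sin (n : ℕ) (x : EuclideanSpace ℝ (Fin n)) :
    ∫ ω : Metric.sphere (0 : EuclideanSpace ℝ (Fin n)) 1,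
      Real.sin ⟪x, (ω : EuclideanSpace ℝ (Fin n))⟫
      ∂(volume : Measure (EuclideanSpace ℝ (Fin n))).toSphere = 0 := by
  have := sphere_invariant n (LinearIsometryEquiv.neg ℝ) (fun y => Real.sin ⟪x, y⟫) (by fun_prop)
  simp [integral_neg] at this
  linarith

lemma uh_eq (n : ℕ) (h : ℝ) (x : EuclideanSpace ℝ (Fin n)) :
    uh n h x = ((h ^ ((1 - (n : ℝ)) / 2) * Jf n (h⁻¹ • x) : ℝ) : ℂ) := by
  unfold uh
  rw [Complex.ofReal_mul]
  congr 1
  have e : ∀ ω : Metric.sphere (0 : EuclideanSpace ℝ (Fin n)) 1,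
      Complex.exp (Complex.I * (⟪x, (ω : EuclideanSpace ℝ (Fin n))⟫ / h)) =
      ((Real.cos ⟪h⁻¹ • x, (ω : EuclideanSpace ℝ (Fin n))⟫ : ℝ) : ℂ) +
      ((Real.sin ⟪h⁻¹ • x, (ω : EuclideanSpace ℝ (Fin n))⟫ : ℝ) : ℂ) * Complex.I := by
    intro ω
    rw [mul_comm, Complex.exp_mul_I]
    push_cast
    rw [real_inner_smul_left]
    push_cast
    rw [div_eq_inv_mul]
  simp_rw [e]
  rw [integral_add, integral_mul_const]
  · rw [integral_complex_ofReal, integral_complex_ofReal, sphere_sin]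
    simp [Jf]
  · exact (sphere_integrable n (fun y => Real.cos ⟪h⁻¹ • x, y⟫) (by fun_prop)).ofReal
  · exact (sphere_integrable n (fun y => Real.sin ⟪h⁻¹ • x, y⟫) (by fun_prop)).ofReal.mul_const _

lemma coord_le (n : ℕ) (ω : Metric.sphere (0 : EuclideanSpace ℝ (Fin n)) 1) (i : Fin n) :
    |(ω : EuclideanSpace ℝ (Fin n)) i| ≤ 1 := by
  have := PiLp.norm_apply_le (ω : EuclideanSpace ℝ (Fin n)) i
  simpa using this

noncomputable def ff (n : ℕ) (i : Fin n) (r : ℝ) : ℝ :=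
  ∫ ω : Metric.sphere (0 : EuclideanSpace ℝ (Fin n)) 1,
      Real.cos (r * (ω : EuclideanSpace ℝ (Fin n)) i)
      ∂(volume : Measure (EuclideanSpace ℝ (Fin n))).toSphere

noncomputable def ff1 (n : ℕ) (i : Fin n) (r : ℝ) : ℝ :=
  ∫ ω : Metric.sphere (0 : EuclideanSpace ℝ (Fin n)) 1,
      -((ω : EuclideanSpace ℝ (Fin n)) i * Real.sin (r * (ω : EuclideanSpace ℝ (Fin n)) i))
      ∂(volume : Measure (EuclideanSpace ℝ (Fin n))).toSphere

lemma Jf_eq_ff (n : ℕ) (i : Fin n) (x : EuclideanSpace ℝ (Fin n)) : Jf n x = ff n i ‖x‖ := by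
  rw [Jf_radial n x (‖x‖ • EuclideanSpace.single i 1) (by simp [norm_smul])]
  simp [Jf, ff, real_inner_smul_left, EuclideanSpace.inner_single_left]

lemma ff_deriv (n : ℕ) (i : Fin n) (r : ℝ) : HasDerivAt (ff n i) (ff1 n i r) r := by
  refine hasDerivAt_int (volume : Measure (EuclideanSpace ℝ (Fin n))).toSphere (fun r ω =>
    Real.cos (r * (ω : EuclideanSpace ℝ (Fin n)) i)) (fun r ω => -((ω : EuclideanSpace ℝ (Fin n)) i *
    Real.sin (r * (ω : EuclideanSpace ℝ (Fin n)) i))) 1 ?_ ?_ ?_ ?_ r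
  · intro t; fun_prop
  · intro t; fun_prop
  · intro t ω
    rw [abs_neg, abs_mul]
    exact mul_le_one₀ (coord_le n ω i) (abs_nonneg _) (Real.abs_sin_le_one _)
  · intro t ω
    refine (((hasDerivAt_id t).mul_const _).cos).congr_deriv ?_
    simp; ring

lemma ff1_deriv' (n : ℕ) (i : Fin n) (r : ℝ) : HasDerivAt (ff1 n i)
    (∫ ω : Metric.sphere (0 : EuclideanSpace ℝ (Fin n)) 1,
      -((ω : EuclideanSpace ℝ (Fin n)) i ^ 2 * Real.cos (r * (ω : EuclideanSpace ℝ (Fin n)) i))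
      ∂(volume : Measure (EuclideanSpace ℝ (Fin n))).toSphere) r := by
  refine hasDerivAt_int (volume : Measure (EuclideanSpace ℝ (Fin n))).toSphere (fun r ω =>
    -((ω : EuclideanSpace ℝ (Fin n)) i * Real.sin (r * (ω : EuclideanSpace ℝ (Fin n)) i)))
    (fun r ω => -((ω : EuclideanSpace ℝ (Fin n)) i ^ 2 *
    Real.cos (r * (ω : EuclideanSpace ℝ (Fin n)) i))) 1 ?_ ?_ ?_ ?_ r
  · intro t; fun_prop
  · intro t; fun_prop
  · intro t ω
    rw [abs_neg, abs_mul, abs_pow]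
    exact mul_le_one₀ (pow_le_one₀ (abs_nonneg _) (coord_le n ω i)) (abs_nonneg _) (Real.abs_cos_le_one _)
  · intro t ω
    refine ((((hasDerivAt_id t).mul_const _).sin).const_mul _).neg.congr_deriv ?_
    simp; ring

/-- Rotational integration by parts. -/
lemma ff_rot (n : ℕ) (i j : Fin n) (hij : i ≠ j) (r : ℝ) (hr : 0 < r) :
    ∫ ω : Metric.sphere (0 : EuclideanSpace ℝ (Fin n)) 1,
      (r * (ω : EuclideanSpace ℝ (Fin n)) j ^ 2 * Real.cos (r * (ω : EuclideanSpace ℝ (Fin n)) i)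
      - (ω : EuclideanSpace ℝ (Fin n)) i * Real.sin (r * (ω : EuclideanSpace ℝ (Fin n)) i))
      ∂(volume : Measure (EuclideanSpace ℝ (Fin n))).toSphere = 0 := by
  set P : ℝ → EuclideanSpace ℝ (Fin n) → ℝ := fun t ω => r * (Real.cos t * ω i + Real.sin t * ω j)
    with hP
  set Q : ℝ → EuclideanSpace ℝ (Fin n) → ℝ := fun t ω => r * (-Real.sin t * ω i + Real.cos t * ω j)
    with hQ
  have hPd : ∀ t ω, HasDerivAt (fun t => P t ω) (Q t ω) t := fun t ω =>
    ((((Real.hasDerivAt_cos t).mul_const _).add ((Real.hasDerivAt_sin t).mul_const _)).const_mul r)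
  have hQd : ∀ t ω, HasDerivAt (fun t => Q t ω) (- P t ω) t := fun t ω => by
    refine ((((Real.hasDerivAt_sin t).neg.mul_const _).add
      ((Real.hasDerivAt_cos t).mul_const _)).const_mul r).congr_deriv ?_
    simp only [hP]; ring
  have hPc : ∀ t, Continuous (P t) := fun t => by simp only [hP]; fun_prop
  have hQc : ∀ t, Continuous (Q t) := fun t => by simp only [hQ]; fun_prop
  have hPb : ∀ t, ∀ ω : Metric.sphere (0 : EuclideanSpace ℝ (Fin n)) 1, |P t ω| ≤ r * 2 := by
    intro t ω
    simp only [hP]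
    rw [abs_mul, abs_of_pos hr]
    gcongr
    refine (abs_add_le _ _).trans ?_
    rw [abs_mul, abs_mul]
    have := mul_le_one₀ (Real.abs_cos_le_one t) (abs_nonneg _) (coord_le n ω i)
    have := mul_le_one₀ (Real.abs_sin_le_one t) (abs_nonneg _) (coord_le n ω j)
    linarith
  have hQb : ∀ t, ∀ ω : Metric.sphere (0 : EuclideanSpace ℝ (Fin n)) 1, |Q t ω| ≤ r * 2 := by
    intro t ω
    simp only [hQ]
    rw [abs_mul, abs_of_pos hr]
    gcongr
    refine (abs_add_le _ _).trans ?_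
    rw [abs_mul, abs_mul, abs_neg]
    have := mul_le_one₀ (Real.abs_sin_le_one t) (abs_nonneg _) (coord_le n ω i)
    have := mul_le_one₀ (Real.abs_cos_le_one t) (abs_nonneg _) (coord_le n ω j)
    linarith
  have d1 := hasDerivAt_int (volume : Measure (EuclideanSpace ℝ (Fin n))).toSphere
    (fun t ω => Real.cos (P t ω)) (fun t ω => -Real.sin (P t ω) * Q t ω) (r * 2)
    (fun t => by have := hPc t; fun_prop) (fun t => by have := hPc t; have := hQc t; fun_prop)
    (fun t ω => by
      rw [abs_mul, abs_neg]
      have := mul_le_mul (Real.abs_sin_le_one (P t ω)) (hQb t ω) (abs_nonneg _) zero_le_one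
      linarith)
    (fun t ω => (hPd t ω).cos)
  have d2 := hasDerivAt_int (volume : Measure (EuclideanSpace ℝ (Fin n))).toSphere
    (fun t ω => -Real.sin (P t ω) * Q t ω)
    (fun t ω => -(Real.cos (P t ω) * Q t ω) * Q t ω + -Real.sin (P t ω) * (-P t ω))
    ((r * 2) * (r * 2) + r * 2)
    (fun t => by have := hPc t; have := hQc t; fun_prop)
    (fun t => by have := hPc t; have := hQc t; fun_prop)
    (fun t ω => by
      refine (abs_add_le _ _).trans ?_
      rw [abs_mul (-_), abs_neg, abs_mul (Real.cos _), abs_mul (-Real.sin _), abs_neg, abs_neg]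
      have h1 := mul_le_mul (Real.abs_sin_le_one (P t ω)) (hPb t ω) (abs_nonneg _) zero_le_one
      have h2 := mul_le_mul (Real.abs_cos_le_one (P t ω)) (hQb t ω) (abs_nonneg _) zero_le_one
      have h3 := mul_le_mul h2 (hQb t ω) (abs_nonneg _) (by positivity)
      linarith)
    (fun t ω => ((hPd t ω).sin.neg).mul (hQd t ω))
  have hconst : ∀ t, ∫ ω : Metric.sphere (0 : EuclideanSpace ℝ (Fin n)) 1, Real.cos (P t ω)
      ∂(volume : Measure (EuclideanSpace ℝ (Fin n))).toSphere = ff n i r := by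
    intro t
    set x : EuclideanSpace ℝ (Fin n) := r • (Real.cos t • EuclideanSpace.single i 1 +
      Real.sin t • EuclideanSpace.single j 1) with hx
    have hin : ∀ ω : EuclideanSpace ℝ (Fin n), ⟪x, ω⟫ = P t ω := by
      intro ω
      simp [hx, hP, real_inner_smul_left, inner_add_left, EuclideanSpace.inner_single_left]
      ring
    have hnorm : ‖x‖ = r := by
      have h2 : ‖x‖ ^ 2 = r ^ 2 := by
        rw [← real_inner_self_eq_norm_sq, hin]
        simp only [hP, hx]
        simp [hij, hij.symm]
        have := Real.sin_sq_add_cos_sq t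
        linear_combination r ^ 2 * this
      exact (sq_eq_sq₀ (norm_nonneg _) hr.le).1 h2
    have := Jf_eq_ff n i x
    rw [hnorm] at this
    rw [← this, Jf]
    simp_rw [hin]
  have hz : ∀ t, ∫ ω : Metric.sphere (0 : EuclideanSpace ℝ (Fin n)) 1, -Real.sin (P t ω) * Q t ω
      ∂(volume : Measure (EuclideanSpace ℝ (Fin n))).toSphere = 0 := by
    intro t
    have h1 := d1 t
    simp_rw [hconst] at h1
    exact h1.unique (hasDerivAt_const _ _)
  have h2 := d2 0
  simp_rw [hz] at h2
  have h3 := h2.unique (hasDerivAt_const _ _)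
  simp only [hP, hQ, Real.cos_zero, Real.sin_zero] at h3
  have h4 : ∫ ω : Metric.sphere (0 : EuclideanSpace ℝ (Fin n)) 1,
      -r * (r * (ω : EuclideanSpace ℝ (Fin n)) j ^ 2 * Real.cos (r * (ω : EuclideanSpace ℝ (Fin n)) i)
      - (ω : EuclideanSpace ℝ (Fin n)) i * Real.sin (r * (ω : EuclideanSpace ℝ (Fin n)) i))
      ∂(volume : Measure (EuclideanSpace ℝ (Fin n))).toSphere = 0 := by
    rw [← h3]
    congr 1
    ext ω
    simp only [one_mul, zero_mul, add_zero, neg_zero, zero_add]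
    ring
  rw [integral_const_mul] at h4
  rcases mul_eq_zero.1 h4 with h | h
  · linarith
  · exact h

lemma ff1_deriv (n : ℕ) (i : Fin n) (r : ℝ) (hr : 0 < r) :
    HasDerivAt (ff1 n i) (-(((n : ℝ) - 1) / r * ff1 n i r) - ff n i r) r := by
  refine (ff1_deriv' n i r).congr_deriv ?_
  have hs : ∑ j ∈ Finset.univ.erase i, ∫ ω : Metric.sphere (0 : EuclideanSpace ℝ (Fin n)) 1,
      (r * (ω : EuclideanSpace ℝ (Fin n)) j ^ 2 * Real.cos (r * (ω : EuclideanSpace ℝ (Fin n)) i)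
      - (ω : EuclideanSpace ℝ (Fin n)) i * Real.sin (r * (ω : EuclideanSpace ℝ (Fin n)) i))
      ∂(volume : Measure (EuclideanSpace ℝ (Fin n))).toSphere = 0 :=
    Finset.sum_eq_zero fun j hj => ff_rot n i j (Finset.ne_of_mem_erase hj).symm r hr
  rw [← integral_finsetSum _ (fun j _ => sphere_integrable n
    (fun ω => r * ω j ^ 2 * Real.cos (r * ω i) - ω i * Real.sin (r * ω i)) (by fun_prop))] at hs
  have e : ∀ ω : Metric.sphere (0 : EuclideanSpace ℝ (Fin n)) 1,
      ∑ j ∈ Finset.univ.erase i, (r * (ω : EuclideanSpace ℝ (Fin n)) j ^ 2 *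
        Real.cos (r * (ω : EuclideanSpace ℝ (Fin n)) i)
      - (ω : EuclideanSpace ℝ (Fin n)) i * Real.sin (r * (ω : EuclideanSpace ℝ (Fin n)) i)) =
      r * Real.cos (r * (ω : EuclideanSpace ℝ (Fin n)) i)
      + r * -((ω : EuclideanSpace ℝ (Fin n)) i ^ 2 * Real.cos (r * (ω : EuclideanSpace ℝ (Fin n)) i))
      + ((n : ℝ) - 1) * -((ω : EuclideanSpace ℝ (Fin n)) i *
        Real.sin (r * (ω : EuclideanSpace ℝ (Fin n)) i)) := by
    intro ω
    have hn1 : 1 ≤ n := Nat.one_le_iff_ne_zero.2 (fun h => by subst h; exact i.elim0)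
    have h1 : ∑ j, (ω : EuclideanSpace ℝ (Fin n)) j ^ 2 = 1 := by
      rw [← EuclideanSpace.real_norm_sq_eq]; simp
    have h2 := Finset.add_sum_erase Finset.univ
      (fun j => (ω : EuclideanSpace ℝ (Fin n)) j ^ 2) (Finset.mem_univ i)
    rw [h1] at h2
    rw [Finset.sum_sub_distrib, ← Finset.sum_mul, ← Finset.mul_sum, Finset.sum_const,
      Finset.card_erase_of_mem (Finset.mem_univ i), Finset.card_univ, Fintype.card_fin, nsmul_eq_mul,
      Nat.cast_sub hn1]
    simp only at h2
    push_cast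
    linear_combination r * Real.cos (r * (ω : EuclideanSpace ℝ (Fin n)) i) * h2
  simp_rw [e] at hs
  have i1 := sphere_integrable n (fun ω => r * Real.cos (r * ω i)) (by fun_prop)
  have i2 := sphere_integrable n (fun ω => r * -(ω i ^ 2 * Real.cos (r * ω i))) (by fun_prop)
  have i3 := sphere_integrable n (fun ω => ((n:ℝ) - 1) * -(ω i * Real.sin (r * ω i))) (by fun_prop)
  rw [integral_add (by exact i1.add i2) i3, integral_add i1 i2, integral_const_mul, integral_const_mul,
    integral_const_mul] at hs
  change r * ff n i r + _ + (n - 1) * ff1 n i r = 0 at hs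
  have key : ∀ Z F F1 : ℝ, r * F + r * Z + (n - 1) * F1 = 0 → Z = -(((n : ℝ) - 1) / r * F1) - F := by
    intro Z F F1 h
    field_simp
    linarith
  exact key _ _ _ hs

lemma ff_zero (n : ℕ) (i : Fin n) : 0 < ff n i 0 := by
  have : Nontrivial (EuclideanSpace ℝ (Fin n)) :=
    ⟨⟨EuclideanSpace.single i 1, 0, by
      intro h; have := congrArg (fun v => v i) h; simp at this⟩⟩
  have h := (volume : Measure (EuclideanSpace ℝ (Fin n))).toSphere_ne_zero
  simp only [ff, zero_mul, Real.cos_zero, integral_const, smul_eq_mul, mul_one]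
  rw [Measure.real, ENNReal.toReal_pos_iff]
  exact ⟨pos_iff_ne_zero.2 (Measure.measure_univ_ne_zero.2 h), measure_lt_top _ _⟩

lemma ff_cont (n : ℕ) (i : Fin n) : Continuous (ff n i) :=
  continuous_iff_continuousAt.2 fun r => (ff_deriv n i r).continuousAt

lemma radial_asymp (n : ℕ) (i : Fin n) :
    ∃ L > 0, ∃ K : ℝ, 0 ≤ K ∧ ∀ R ≥ 1,
      |(∫ s in (0:ℝ)..R, s ^ (n - 1) * ff n i s ^ 2) - L * R| ≤ K * (1 + Real.log R) := by
  have hn1 : 1 ≤ n := Nat.one_le_iff_ne_zero.2 (fun h => by subst h; exact i.elim0)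
  set m : ℝ := ((n : ℝ) - 1) / 2 with hm
  set g : ℝ → ℝ := fun r => r ^ m * ff n i r with hg
  set g1 : ℝ → ℝ := fun r => m * r ^ (m - 1) * ff n i r + r ^ m * ff1 n i r with hg1
  have hgd : ∀ r > 0, HasDerivAt g (g1 r) r := fun r hr =>
    (Real.hasDerivAt_rpow_const (Or.inl hr.ne')).mul (ff_deriv n i r)
  have hg1d : ∀ r > 0, HasDerivAt g1 (-(1 - m * (m - 1) / r ^ 2) * g r) r := by
    intro r hr
    have h1 := (((Real.hasDerivAt_rpow_const (p := m - 1) (Or.inl hr.ne')).const_mul m).mul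
      (ff_deriv n i r)).add
      ((Real.hasDerivAt_rpow_const (p := m) (Or.inl hr.ne')).mul (ff1_deriv n i r hr))
    refine h1.congr_deriv ?_
    have e1 : r ^ (m - 1) = r ^ m / r := by rw [Real.rpow_sub hr, Real.rpow_one]
    have e2 : r ^ (m - 1 - 1) = r ^ m / r / r := by rw [Real.rpow_sub hr, Real.rpow_one, e1]
    have e3 : (n : ℝ) - 1 = 2 * m := by rw [hm]; ring
    simp only [hg]
    rw [e1, e2, e3]
    field_simp
    ring
  have hne : ∃ r > 0, g r ≠ 0 := by
    have h1 : ∀ᶠ r in nhdsWithin (0:ℝ) (Set.Ioi 0), 0 < ff n i r :=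
      ((ff_cont n i).continuousAt.eventually (lt_mem_nhds (ff_zero n i))).filter_mono
        nhdsWithin_le_nhds
    obtain ⟨r, hr, hr0⟩ := (h1.and self_mem_nhdsWithin).exists
    exact ⟨r, hr0, (mul_pos (Real.rpow_pos_of_pos hr0 m) hr).ne'⟩
  obtain ⟨L, hL, K, hK, h⟩ := ode_integral g g1 (m * (m - 1)) hgd hg1d hne
  have hc : Continuous (fun s : ℝ => s ^ (n - 1) * ff n i s ^ 2) := by
    have := ff_cont n i
    fun_prop
  set I0 := ∫ s in (0:ℝ)..1, s ^ (n - 1) * ff n i s ^ 2 with hI0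
  refine ⟨L, hL, |I0| + K, by positivity, fun R hR => ?_⟩
  rw [← intervalIntegral.integral_add_adjacent_intervals (b := 1) (hc.intervalIntegrable _ _)
    (hc.intervalIntegrable _ _), ← hI0]
  have e : ∫ s in (1:ℝ)..R, s ^ (n - 1) * ff n i s ^ 2 = ∫ r in (1:ℝ)..R, g r ^ 2 := by
    apply intervalIntegral.integral_congr
    intro s hs
    rw [Set.uIcc_of_le hR] at hs
    have hs0 : 0 < s := lt_of_lt_of_le one_pos hs.1
    simp only [hg]
    rw [mul_pow, ← Real.rpow_natCast, ← Real.rpow_natCast (s ^ m), ← Real.rpow_mul hs0.le, hm,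
      Nat.cast_sub hn1]
    congr 2
    push_cast
    ring
  rw [e, add_sub_assoc]
  refine (abs_add_le _ _).trans ?_
  have := h R hR
  have h2 := mul_nonneg (abs_nonneg I0) (Real.log_nonneg hR)
  linarith

lemma int_uh (n : ℕ) (i : Fin n) (h ε : ℝ) (h0 : 0 < h) (hε : 0 < ε) :
    ∫ x in Metric.closedBall (0 : EuclideanSpace ℝ (Fin n)) ε, ‖uh n h x‖ ^ 2 =
    n * (volume : Measure (EuclideanSpace ℝ (Fin n))).real (Metric.ball 0 1) * h *
      ∫ s in (0:ℝ)..(h⁻¹ * ε), s ^ (n - 1) * ff n i s ^ 2 := by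
  have hn1 : 1 ≤ n := Nat.one_le_iff_ne_zero.2 (fun h => by subst h; exact i.elim0)
  have : Nontrivial (EuclideanSpace ℝ (Fin n)) :=
    ⟨⟨EuclideanSpace.single i 1, 0, by
      intro h; have := congrArg (fun v => v i) h; simp at this⟩⟩
  set F : ℝ → ℝ := (Set.Iic ε).indicator (fun y => (h ^ (n - 1))⁻¹ * ff n i (h⁻¹ * y) ^ 2) with hF
  have e1 : ∀ x, ‖uh n h x‖ ^ 2 = (h ^ (n - 1))⁻¹ * ff n i (h⁻¹ * ‖x‖) ^ 2 := by
    intro x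
    rw [uh_eq, Complex.norm_real, Real.norm_eq_abs, sq_abs, mul_pow, Jf_eq_ff n i, norm_smul,
      norm_inv, Real.norm_of_nonneg h0.le]
    congr 1
    rw [← Real.rpow_natCast, ← Real.rpow_natCast, ← Real.rpow_mul h0.le, ← Real.rpow_neg h0.le,
      Nat.cast_sub hn1]
    congr 1
    push_cast
    ring
  have e2 : ∫ x in Metric.closedBall (0 : EuclideanSpace ℝ (Fin n)) ε, ‖uh n h x‖ ^ 2 =
      ∫ x : EuclideanSpace ℝ (Fin n), F ‖x‖ := by
    rw [← integral_indicator Metric.isClosed_closedBall.measurableSet]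
    congr 1
    ext x
    classical
    simp only [hF, Set.indicator_apply, Metric.mem_closedBall, dist_zero_right, Set.mem_Iic, e1]
  rw [e2, integral_fun_norm_addHaar]
  simp only [finrank_euclideanSpace_fin, nsmul_eq_mul, smul_eq_mul]
  have e3 : ∫ y in Set.Ioi (0:ℝ), y ^ (n - 1) * F y =
      ∫ y in (0:ℝ)..ε, (fun s => s ^ (n - 1) * ff n i s ^ 2) (h⁻¹ * y) := by
    rw [intervalIntegral.integral_of_le hε.le, ← integral_indicator measurableSet_Ioi,
      ← integral_indicator measurableSet_Ioc]
    congr 1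
    ext y
    simp only [hF, Set.indicator_apply, Set.mem_Ioi, Set.mem_Ioc, Set.mem_Iic]
    by_cases a : 0 < y <;> by_cases b : y ≤ ε <;> simp [a, b]
    rw [mul_pow, inv_pow]
    ring
  rw [e3, intervalIntegral.integral_comp_mul_left (fun s => s ^ (n - 1) * ff n i s ^ 2) (inv_ne_zero h0.ne')]
  simp only [inv_inv, mul_zero, smul_eq_mul]
  ring

/-- `L²` normalization of the model quasimode: for
`δ ∈ (1 - 1/n, 1)` and `δ' = min(1-(1-δ)n, δ)` there are a constant `c_n > 0`
depending only on `n` and a constant `C` such that for each `ε₀ ∈ (0,1]` and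
all sufficiently small `ħ`,
`|∫_{|x| ≤ ε₀} |u_ħ|² dx − c_n ε₀| ≤ C ħ^{δ'}`; in particular
`∫_{|x| ≤ ε₀} |u_ħ|² dx → c_n ε₀` as `ħ → 0⁺`. -/
theorem stmt_9 (n : ℕ) (hn : 2 ≤ n) (δ : ℝ) (hδ : δ ∈ Set.Ioo (1 - 1 / (n : ℝ)) 1) :
    ∃ c : ℝ, 0 < c ∧ ∃ C : ℝ, ∀ ε₀ : ℝ, ε₀ ∈ Set.Ioc (0 : ℝ) 1 →
      (∃ h₀ : ℝ, 0 < h₀ ∧ ∀ h : ℝ, 0 < h → h < h₀ →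
        |(∫ x in Metric.closedBall (0 : EuclideanSpace ℝ (Fin n)) ε₀, ‖uh n h x‖ ^ 2)
            - c * ε₀|
          ≤ C * h ^ min (1 - (1 - δ) * (n : ℝ)) δ)
      ∧ Filter.Tendsto
          (fun h : ℝ =>
            ∫ x in Metric.closedBall (0 : EuclideanSpace ℝ (Fin n)) ε₀, ‖uh n h x‖ ^ 2)
          (nhdsWithin 0 (Set.Ioi 0)) (nhds (c * ε₀)) := by
  have hn0 : 0 < n := by omega
  have hnR : (2:ℝ) ≤ n := by exact_mod_cast hn
  obtain ⟨L, hL, K, hK, hF⟩ := radial_asymp n ⟨0, hn0⟩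
  set i : Fin n := ⟨0, hn0⟩
  set a : ℝ := n * (volume : Measure (EuclideanSpace ℝ (Fin n))).real (Metric.ball 0 1) with ha
  have ha0 : 0 < a := by
    have : 0 < (volume : Measure (EuclideanSpace ℝ (Fin n))).real (Metric.ball 0 1) :=
      ENNReal.toReal_pos (Metric.measure_ball_pos _ _ one_pos).ne' measure_ball_lt_top.ne
    positivity
  have hd1 : 0 < 1 - (1 - δ) * (n : ℝ) := by
    have := hδ.1
    have h2 : (1 - δ) < 1 / (n:ℝ) := by linarith
    rw [lt_div_iff₀ (by positivity)] at h2
    linarith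
  have hδ0 : 0 < δ := by
    have := hδ.1
    have h2 : 1 / (n:ℝ) ≤ 1 := by
      rw [div_le_one (by positivity)]; linarith
    linarith
  set d := min (1 - (1 - δ) * (n : ℝ)) δ with hd
  have hd0 : 0 < d := lt_min hd1 hδ0
  have hdlt : d < 1 := lt_of_le_of_lt (min_le_right _ _) hδ.2
  refine ⟨a * L, by positivity, a * (K * (1 + 1 / (1 - d))), fun ε hε => ?_⟩
  have hmain : ∀ h : ℝ, 0 < h → h < ε →
      |(∫ x in Metric.closedBall (0 : EuclideanSpace ℝ (Fin n)) ε, ‖uh n h x‖ ^ 2) - a * L * ε|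
        ≤ a * (K * (1 + 1 / (1 - d))) * h ^ d := by
    intro h h0 hlt
    have hh1 : h ≤ 1 := hlt.le.trans hε.2
    have hR : 1 ≤ h⁻¹ * ε := by
      rw [inv_mul_eq_div, le_div_iff₀ h0]; linarith
    have h1 := hF _ hR
    rw [int_uh n i h ε h0 hε.1]
    have e1 : (n * (volume : Measure (EuclideanSpace ℝ (Fin n))).real (Metric.ball 0 1) * h *
        ∫ s in (0:ℝ)..(h⁻¹ * ε), s ^ (n - 1) * ff n i s ^ 2) - a * L * ε =
        a * h * ((∫ s in (0:ℝ)..(h⁻¹ * ε), s ^ (n - 1) * ff n i s ^ 2) - L * (h⁻¹ * ε)) := by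
      rw [← ha]; field_simp
    rw [e1, abs_mul, abs_of_pos (by positivity : 0 < a * h)]
    have h2 : Real.log (h⁻¹ * ε) ≤ Real.log h⁻¹ := by
      apply Real.log_le_log (by linarith)
      exact mul_le_of_le_one_right (by positivity) hε.2
    have h3 := Real.log_le_rpow_div (x := h⁻¹) (ε := 1 - d) (by positivity) (by linarith)
    have h4 : h * (h⁻¹) ^ (1 - d) = h ^ d := by
      rw [Real.inv_rpow h0.le, ← Real.rpow_neg h0.le]
      nth_rewrite 1 [← Real.rpow_one h]
      rw [← Real.rpow_add h0]
      congr 1; ring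
    have h5 : h ≤ h ^ d := by
      nth_rewrite 1 [← Real.rpow_one h]
      exact Real.rpow_le_rpow_of_exponent_ge h0 hh1 hdlt.le
    calc a * h * |(∫ s in (0:ℝ)..(h⁻¹ * ε), s ^ (n - 1) * ff n i s ^ 2) - L * (h⁻¹ * ε)|
        ≤ a * h * (K * (1 + (h⁻¹) ^ (1 - d) / (1 - d))) := by
          refine mul_le_mul_of_nonneg_left (h1.trans ?_) (by positivity)
          refine mul_le_mul_of_nonneg_left ?_ hK
          linarith
      _ = a * (K * (h + (h * (h⁻¹) ^ (1 - d)) / (1 - d))) := by ring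
      _ = a * (K * (h + h ^ d / (1 - d))) := by rw [h4]
      _ ≤ a * (K * (h ^ d + h ^ d / (1 - d))) := by gcongr
      _ = _ := by ring
  refine ⟨⟨ε, hε.1, hmain⟩, ?_⟩
  rw [tendsto_iff_norm_sub_tendsto_zero]
  have hz : Filter.Tendsto (fun h : ℝ => a * (K * (1 + 1 / (1 - d))) * h ^ d)
      (nhdsWithin 0 (Set.Ioi 0)) (nhds 0) := by
    have h1 : Filter.Tendsto (fun h : ℝ => h ^ d) (nhds 0) (nhds 0) := by
      have := (Real.continuousAt_rpow_const 0 d (Or.inr hd0.le)).tendsto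
      rwa [Real.zero_rpow hd0.ne'] at this
    simpa using (h1.mono_left nhdsWithin_le_nhds).const_mul (a * (K * (1 + 1 / (1 - d))))
  refine squeeze_zero' (Filter.Eventually.of_forall fun _ => norm_nonneg _) ?_ hz
  filter_upwards [Ioo_mem_nhdsGT hε.1] with h hh
  exact hmain h hh.1 hh.2
end
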